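/- Algebraic Poincaré lemma in degree zero for polynomials in fields: if T^μ (μ = 0,…,3) are polynomials in formal field variables and their derivatives (jet variables), linear combinations of monomials of bounded order, and ∂_μ T^μ = 0 identically as a polynomial identity in the jet variables (no field equations imposed), then there exists an antisymmetric T^{μν} = −T^{νμ}, polynomial in the jet variables, with T^μ = ∂_ν T^{μν}, provided each T^μ has no constant term. -/

import Mathlib

open MvPolynomial

/-- Jet variables: formal commuting variables φ_α^{(k)} indexed by a field
label α and a (symmetric) multi-index k : Fin 4 → ℕ. -/
abbrev JetVar (α : Type) : Type := α × (Fin 4 → ℕ)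

/-- The total derivative ∂_μ: the ℝ-derivation of the polynomial algebra in
the jet variables sending φ_α^{(k)} to φ_α^{(k + e_μ)}. -/
noncomputable def totalDeriv (α : Type) (μ : Fin 4) :
    Derivation ℝ (MvPolynomial (JetVar α) ℝ) (MvPolynomial (JetVar α) ℝ) :=
  MvPolynomial.mkDerivation ℝ
    (fun v => X (v.1, fun i => v.2 i + (if i = μ then 1 else 0)))


namespace JetAux

/-- The lowering derivation, dual to the total derivative. -/
noncomputable def lower (α : Type) (μ : Fin 4) :
    Derivation ℝ (MvPolynomial (JetVar α) ℝ) (MvPolynomial (JetVar α) ℝ) :=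
  MvPolynomial.mkDerivation ℝ
    (fun v => (v.2 μ : ℝ) • X (v.1, fun i => v.2 i - (if i = μ then 1 else 0)))

/-- The Euler (number) derivation. -/
noncomputable def euler (α : Type) :
    Derivation ℝ (MvPolynomial (JetVar α) ℝ) (MvPolynomial (JetVar α) ℝ) :=
  MvPolynomial.mkDerivation ℝ (fun v => X v)

variable {α : Type}

lemma total_X (μ : Fin 4) (v : JetVar α) : totalDeriv α μ (X v) =
    X (v.1, fun i => v.2 i + (if i = μ then 1 else 0)) := by
  simp [totalDeriv, mkDerivation_X]

lemma lower_X (μ : Fin 4) (v : JetVar α) : lower α μ (X v) =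
    (v.2 μ : ℝ) • X (v.1, fun i => v.2 i - (if i = μ then 1 else 0)) := by
  simp [lower, mkDerivation_X]

lemma euler_X (v : JetVar α) : euler α (X v) = X v := by
  simp [euler, mkDerivation_X]

lemma total_comm (μ ν : Fin 4) (f : MvPolynomial (JetVar α) ℝ) :
    totalDeriv α μ (totalDeriv α ν f) = totalDeriv α ν (totalDeriv α μ f) := by
  have h : ⁅totalDeriv α μ, totalDeriv α ν⁆ = 0 := by
    apply MvPolynomial.derivation_ext
    intro v
    rw [Derivation.commutator_apply]
    simp only [total_X, Derivation.zero_apply, sub_eq_zero]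
    congr 2
    funext i
    omega
  have := congrArg (fun d => d f) h
  simpa [Derivation.commutator_apply, sub_eq_zero] using this

lemma euler_total (μ : Fin 4) (f : MvPolynomial (JetVar α) ℝ) :
    euler α (totalDeriv α μ f) = totalDeriv α μ (euler α f) := by
  have h : ⁅euler α, totalDeriv α μ⁆ = 0 := by
    apply MvPolynomial.derivation_ext
    intro v
    rw [Derivation.commutator_apply]
    simp only [total_X, euler_X, Derivation.zero_apply, sub_self]
  have := congrArg (fun d => d f) h
  simpa [Derivation.commutator_apply, sub_eq_zero] using this

lemma euler_lower (μ : Fin 4) (f : MvPolynomial (JetVar α) ℝ) :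
    euler α (lower α μ f) = lower α μ (euler α f) := by
  have h : ⁅euler α, lower α μ⁆ = 0 := by
    apply MvPolynomial.derivation_ext
    intro v
    rw [Derivation.commutator_apply]
    simp only [lower_X, euler_X, Derivation.map_smul, Derivation.zero_apply, sub_self]
  have := congrArg (fun d => d f) h
  simpa [Derivation.commutator_apply, sub_eq_zero] using this

lemma lower_total_ne {μ ν : Fin 4} (hne : μ ≠ ν) (f : MvPolynomial (JetVar α) ℝ) :
    lower α μ (totalDeriv α ν f) = totalDeriv α ν (lower α μ f) := by
  have h : ⁅lower α μ, totalDeriv α ν⁆ = 0 := by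
    apply MvPolynomial.derivation_ext
    intro v
    rw [Derivation.commutator_apply]
    simp only [lower_X, total_X, Derivation.map_smul, Derivation.zero_apply, sub_eq_zero]
    rw [if_neg hne, add_zero]
    congr 3
    funext i
    by_cases h1 : i = μ
    · subst h1
      simp [hne]
    · simp [h1]
  have := congrArg (fun d => d f) h
  simpa [Derivation.commutator_apply, sub_eq_zero] using this

lemma lower_total_self (μ : Fin 4) (f : MvPolynomial (JetVar α) ℝ) :
    lower α μ (totalDeriv α μ f) = totalDeriv α μ (lower α μ f) + euler α f := by
  have h : ⁅lower α μ, totalDeriv α μ⁆ = euler α := by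
    apply MvPolynomial.derivation_ext
    intro v
    rw [Derivation.commutator_apply]
    simp only [lower_X, total_X, euler_X, Derivation.map_smul, sub_eq_iff_eq_add]
    obtain ⟨a, k⟩ := v
    simp only [if_true, Nat.add_sub_cancel]
    rcases Nat.eq_zero_or_pos (k μ) with h0 | h0
    · simp [h0]
    · have : (fun i => k i - (if i = μ then 1 else 0) + (if i = μ then 1 else 0)) = k := by
        funext i
        by_cases h1 : i = μ
        · subst h1
          simp only [if_true]
          omega
        · simp [h1]
      rw [this]
      push_cast
      rw [add_smul, one_smul, add_comm]
  have := congrArg (fun d => d f) h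
  rw [Derivation.commutator_apply, sub_eq_iff_eq_add] at this
  rw [this, add_comm]

lemma const_deriv (d : Derivation ℝ (MvPolynomial (JetVar α) ℝ) (MvPolynomial (JetVar α) ℝ))
    (h : ∀ v, constantCoeff (d (X v)) = 0) (f : MvPolynomial (JetVar α) ℝ) :
    constantCoeff (d f) = 0 := by
  induction f using MvPolynomial.induction_on with
  | C a => simp
  | add p q hp hq => simp [hp, hq]
  | mul_X p v hp => simp [Derivation.leibniz, h]

lemma const_total (μ : Fin 4) (f : MvPolynomial (JetVar α) ℝ) :
    constantCoeff (totalDeriv α μ f) = 0 :=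
  const_deriv _ (fun v => by simp [total_X]) f

lemma const_lower (μ : Fin 4) (f : MvPolynomial (JetVar α) ℝ) :
    constantCoeff (lower α μ f) = 0 :=
  const_deriv _ (fun v => by simp [lower_X]) f

lemma euler_monomial (s : JetVar α →₀ ℕ) (c : ℝ) :
    euler α (monomial s c) = monomial s ((s.degree : ℝ) * c) := by
  rw [euler, mkDerivation_monomial]
  have hd : s.degree = ∑ i ∈ s.support, s i := Finsupp.degree_apply s
  rw [hd]
  simp only [Finsupp.sum]
  push_cast
  rw [Finset.sum_mul, map_sum, Finset.smul_sum]
  refine Finset.sum_congr rfl fun i hi => ?_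
  have hi' : Finsupp.single i 1 ≤ s := by
    rw [Finsupp.single_le_iff]
    exact Nat.one_le_iff_ne_zero.2 (Finsupp.mem_support_iff.1 hi)
  rw [smul_eq_mul, X, monomial_mul, tsub_add_cancel_of_le hi', smul_monomial]
  simp [mul_comm]

lemma coeff_euler (s : JetVar α →₀ ℕ) (f : MvPolynomial (JetVar α) ℝ) :
    coeff s (euler α f) = (s.degree : ℝ) * coeff s f := by
  induction f using MvPolynomial.induction_on' with
  | monomial u a =>
    classical
    rw [euler_monomial, coeff_monomial, coeff_monomial]
    split_ifs with h
    · rw [h]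
    · simp
  | add p q hp hq => rw [map_add, coeff_add, coeff_add, hp, hq, mul_add]

lemma euler_inj (f : MvPolynomial (JetVar α) ℝ) (h0 : constantCoeff f = 0)
    (h : euler α f = 0) : f = 0 := by
  ext s
  have := coeff_euler s f
  rw [h, coeff_zero] at this
  rw [coeff_zero]
  rcases mul_eq_zero.1 this.symm with h1 | h1
  · have h2 : s = 0 := (Finsupp.degree_eq_zero_iff s).1 (by exact_mod_cast h1)
    rw [h2]
    exact h0
  · exact h1

lemma euler_surj (f : MvPolynomial (JetVar α) ℝ) : ∃ h c, f = euler α h + C c := by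
  induction f using MvPolynomial.induction_on' with
  | monomial u a =>
    by_cases hu : u = 0
    · exact ⟨0, a, by subst hu; simp⟩
    · refine ⟨monomial u ((u.degree : ℝ)⁻¹ * a), 0, ?_⟩
      have : (u.degree : ℝ) ≠ 0 := by
        exact_mod_cast fun h => hu ((Finsupp.degree_eq_zero_iff u).1 h)
      rw [euler_monomial, mul_inv_cancel_left₀ this]
      simp
  | add p q hp hq =>
    obtain ⟨h, c, rfl⟩ := hp
    obtain ⟨h', c', rfl⟩ := hq
    exact ⟨h + h', c + c', by simp only [map_add]; ring⟩

/-- Sums of total derivatives in the directions of `s`. -/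
def inI (s : Finset (Fin 4)) (f : MvPolynomial (JetVar α) ℝ) : Prop :=
  ∃ g : Fin 4 → MvPolynomial (JetVar α) ℝ, f = ∑ i ∈ s, totalDeriv α i (g i)

lemma inI_add {s : Finset (Fin 4)} {f f' : MvPolynomial (JetVar α) ℝ}
    (h : inI s f) (h' : inI s f') : inI s (f + f') := by
  obtain ⟨g, rfl⟩ := h
  obtain ⟨g', rfl⟩ := h'
  exact ⟨fun i => g i + g' i, by simp [Finset.sum_add_distrib]⟩

lemma inI_smul {s : Finset (Fin 4)} (c : ℝ) {f : MvPolynomial (JetVar α) ℝ}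
    (h : inI s f) : inI s (c • f) := by
  obtain ⟨g, rfl⟩ := h
  exact ⟨fun i => c • g i, by simp [Finset.smul_sum]⟩

lemma inI_total {s : Finset (Fin 4)} (μ : Fin 4) {f : MvPolynomial (JetVar α) ℝ}
    (h : inI s f) : inI s (totalDeriv α μ f) := by
  obtain ⟨g, rfl⟩ := h
  refine ⟨fun i => totalDeriv α μ (g i), ?_⟩
  rw [map_sum]
  exact Finset.sum_congr rfl fun i _ => total_comm _ _ _

lemma inI_lower {s : Finset (Fin 4)} {μ : Fin 4} (hμ : μ ∉ s)
    {f : MvPolynomial (JetVar α) ℝ}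
    (h : inI s f) : inI s (lower α μ f) := by
  obtain ⟨g, rfl⟩ := h
  refine ⟨fun i => lower α μ (g i), ?_⟩
  rw [map_sum]
  exact Finset.sum_congr rfl fun i hi => lower_total_ne (by rintro rfl; exact hμ hi) _

lemma inI_euler {s : Finset (Fin 4)} {f : MvPolynomial (JetVar α) ℝ}
    (h0 : constantCoeff f = 0) (h : inI s (euler α f)) : inI s f := by
  obtain ⟨g, hg⟩ := h
  choose h c hc using fun i => euler_surj (g i)
  refine ⟨h, ?_⟩
  rw [← sub_eq_zero]
  apply euler_inj
  · rw [map_sub, h0, map_sum]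
    simp [const_total]
  · rw [map_sub, hg, map_sum, sub_eq_zero]
    refine Finset.sum_congr rfl fun i _ => ?_
    rw [euler_total]
    conv_lhs => rw [hc i]
    rw [map_add]
    simp [← algebraMap_eq]

lemma lower_iter_total (μ : Fin 4) (m : ℕ) (f : MvPolynomial (JetVar α) ℝ) :
    (lower α μ)^[m + 1] (totalDeriv α μ f) =
      totalDeriv α μ ((lower α μ)^[m + 1] f) +
        ((m : ℝ) + 1) • euler α ((lower α μ)^[m] f) := by
  induction m with
  | zero => simp [lower_total_self]
  | succ m ih =>
    rw [Function.iterate_succ_apply', ih, map_add, lower_total_self, Derivation.map_smul,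
      ← euler_lower, ← Function.iterate_succ_apply' (lower α μ),
      ← Function.iterate_succ_apply' (lower α μ)]
    push_cast
    module

lemma iter_zero (d : Derivation ℝ (MvPolynomial (JetVar α) ℝ) (MvPolynomial (JetVar α) ℝ))
    (m : ℕ) : d^[m] 0 = 0 := by
  induction m with
  | zero => rfl
  | succ m ih => rw [Function.iterate_succ_apply, map_zero, ih]

lemma iter_add (d : Derivation ℝ (MvPolynomial (JetVar α) ℝ) (MvPolynomial (JetVar α) ℝ))
    (m : ℕ) (f g : MvPolynomial (JetVar α) ℝ) : d^[m] (f + g) = d^[m] f + d^[m] g := by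
  induction m generalizing f g with
  | zero => rfl
  | succ m ih => simp only [Function.iterate_succ_apply, map_add, ih]

lemma iter_smul (d : Derivation ℝ (MvPolynomial (JetVar α) ℝ) (MvPolynomial (JetVar α) ℝ))
    (m : ℕ) (c : ℝ) (f : MvPolynomial (JetVar α) ℝ) : d^[m] (c • f) = c • d^[m] f := by
  induction m generalizing f with
  | zero => rfl
  | succ m ih => simp only [Function.iterate_succ_apply, Derivation.map_smul, ih]

lemma iter_mul (d : Derivation ℝ (MvPolynomial (JetVar α) ℝ) (MvPolynomial (JetVar α) ℝ))
    (n : ℕ) : ∀ (a b : ℕ) (f g : MvPolynomial (JetVar α) ℝ), a + b = n → d^[a] f = 0 →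
      d^[b] g = 0 → d^[n] (f * g) = 0 := by
  induction n with
  | zero =>
    intro a b f g hab hf hg
    obtain rfl : a = 0 := by omega
    have : f = 0 := hf
    simp [this]
  | succ n ih =>
    intro a b f g hab hf hg
    rcases a with _ | a
    · have : f = 0 := hf
      rw [this, zero_mul, iter_zero]
    rcases b with _ | b
    · have : g = 0 := hg
      rw [this, mul_zero, iter_zero]
    rw [Function.iterate_succ_apply, Derivation.leibniz, iter_add, smul_eq_mul, smul_eq_mul,
      ih (a + 1) b f (d g) (by omega) hf (by rwa [Function.iterate_succ_apply] at hg),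
      ih (b + 1) a g (d f) (by omega) hg (by rwa [Function.iterate_succ_apply] at hf), add_zero]

lemma iter_le (d : Derivation ℝ (MvPolynomial (JetVar α) ℝ) (MvPolynomial (JetVar α) ℝ))
    {m n : ℕ} (h : m ≤ n) {f : MvPolynomial (JetVar α) ℝ} (hf : d^[m] f = 0) :
    d^[n] f = 0 := by
  obtain ⟨k, rfl⟩ := Nat.exists_eq_add_of_le h
  rw [add_comm, Function.iterate_add_apply, hf, iter_zero]

lemma nilp_X (μ : Fin 4) (n : ℕ) : ∀ v : JetVar α, v.2 μ = n →
    (lower α μ)^[n + 1] (X v) = 0 := by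
  induction n with
  | zero => intro v hv; simp [lower_X, hv]
  | succ n ih =>
    intro v hv
    rw [Function.iterate_succ_apply, lower_X, iter_smul, ih _ (by simp [hv]), smul_zero]

lemma nilp (μ : Fin 4) (f : MvPolynomial (JetVar α) ℝ) : ∃ m, (lower α μ)^[m] f = 0 := by
  induction f using MvPolynomial.induction_on with
  | C a => exact ⟨1, by simp⟩
  | add p q hp hq =>
    obtain ⟨a, ha⟩ := hp
    obtain ⟨b, hb⟩ := hq
    exact ⟨max a b, by rw [iter_add, iter_le _ (le_max_left a b) ha,
      iter_le _ (le_max_right a b) hb, add_zero]⟩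
  | mul_X p v hp =>
    obtain ⟨a, ha⟩ := hp
    exact ⟨_, iter_mul _ _ a _ _ _ rfl ha (nilp_X μ _ v rfl)⟩

lemma regular {s : Finset (Fin 4)} {μ : Fin 4} (hμ : μ ∉ s) (f : MvPolynomial (JetVar α) ℝ)
    (h0 : constantCoeff f = 0) (h : inI s (totalDeriv α μ f)) : inI s f := by
  have hk : ∀ m, inI s ((lower α μ)^[m] (totalDeriv α μ f)) := by
    intro m
    induction m with
    | zero => exact h
    | succ m ih => rw [Function.iterate_succ_apply']; exact inI_lower hμ ih
  have hc : ∀ m, constantCoeff ((lower α μ)^[m] f) = 0 := by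
    intro m
    cases m with
    | zero => exact h0
    | succ m => rw [Function.iterate_succ_apply']; exact const_lower _ _
  have key : ∀ m, inI s ((lower α μ)^[m] f) → inI s f := by
    intro m
    induction m with
    | zero => exact id
    | succ m ih =>
      intro hm
      apply ih
      apply inI_euler (hc m)
      have h1 := inI_add (hk (m + 1)) (inI_smul (-1) (inI_total μ hm))
      rw [lower_iter_total] at h1
      have h2 := inI_smul ((m : ℝ) + 1)⁻¹ h1
      have hne : (m : ℝ) + 1 ≠ 0 := by positivity
      convert h2 using 1
      rw [neg_one_smul, add_neg_cancel_comm, smul_smul, inv_mul_cancel₀ hne, one_smul]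
  obtain ⟨m, hm⟩ := nilp μ f
  exact key m (by rw [hm]; exact ⟨0, by simp⟩)

lemma main (s : Finset (Fin 4)) : ∀ (T : Fin 4 → MvPolynomial (JetVar α) ℝ),
    (∀ μ, constantCoeff (T μ) = 0) → ∑ μ ∈ s, totalDeriv α μ (T μ) = 0 →
    ∃ S : Fin 4 → Fin 4 → MvPolynomial (JetVar α) ℝ,
      (∀ μ ν, S μ ν = - S ν μ) ∧
      (∀ μ ∈ s, T μ = ∑ ν ∈ s, totalDeriv α ν (S μ ν)) := by
  induction s using Finset.induction_on with
  | empty => exact fun T _ _ => ⟨0, by simp, by simp⟩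
  | insert a s ha ih =>
    intro T h0 hT
    rw [Finset.sum_insert ha] at hT
    obtain ⟨g, hg⟩ : inI s (T a) := regular ha _ (h0 a)
      ⟨fun i => - T i, by simp [eq_neg_of_add_eq_zero_left hT]⟩
    obtain ⟨S, hS, hS'⟩ := ih (fun i => T i + totalDeriv α a (g i))
      (fun i => by simp [h0, const_total]) (by
        have e : totalDeriv α a (T a) =
            ∑ i ∈ s, totalDeriv α i (totalDeriv α a (g i)) := by
          rw [hg, map_sum]
          exact Finset.sum_congr rfl fun i _ => total_comm _ _ _
        simp only [map_add, Finset.sum_add_distrib]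
        rw [← e, add_comm]
        exact hT)
    refine ⟨fun i j => if i = a then (if j = a then 0 else g j) else
      (if j = a then - g i else S i j), ?_, ?_⟩
    · intro i j
      by_cases hi : i = a <;> by_cases hj : j = a <;> simp [hi, hj]
      exact hS i j
    · intro i hi
      rw [Finset.sum_insert ha]
      have hsa : ∀ j ∈ s, j ≠ a := fun j hj h => ha (h ▸ hj)
      rcases Finset.mem_insert.1 hi with rfl | hi
      · simp only [if_true, map_zero, zero_add]
        conv_lhs => rw [hg]
        exact Finset.sum_congr rfl fun j hj => by rw [if_neg (hsa j hj)]
      · simp only [if_neg (hsa i hi), if_true, map_neg]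
        rw [eq_neg_add_iff_add_eq, add_comm, hS' i hi]
        exact Finset.sum_congr rfl fun j hj => by rw [if_neg (hsa j hj)]

end JetAux

/-- algebraic Poincaré lemma in degree zero. If T^μ
(μ = 0,…,3) are polynomials in the jet variables with no constant term and
∂_μ T^μ = 0 identically (no field equations imposed), then there is an
antisymmetric T^{μν} = −T^{νμ}, polynomial in the jet variables, with
T^μ = ∂_ν T^{μν}. -/
theorem algebraic_poincare_lemma_degree_zero
    (α : Type)
    (T : Fin 4 → MvPolynomial (JetVar α) ℝ)
    (hconst : ∀ μ, constantCoeff (T μ) = 0)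
    (hdiv : ∑ μ : Fin 4, totalDeriv α μ (T μ) = 0) :
    ∃ S : Fin 4 → Fin 4 → MvPolynomial (JetVar α) ℝ,
      (∀ μ ν, S μ ν = - S ν μ) ∧
      (∀ μ, T μ = ∑ ν : Fin 4, totalDeriv α ν (S μ ν)) := by
  obtain ⟨S, h1, h2⟩ := JetAux.main Finset.univ T hconst hdiv
  exact ⟨S, h1, fun μ => h2 μ (Finset.mem_univ μ)⟩
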